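/- For every x > 0 one has |ψ₁(x)| ≤ min(x + √(2x/π), 2); in particular |ψ₁(x)| ≤ min(2√x, 2). -/

import Mathlib

open Real MeasureTheory Set

/-- `η t = (1/4)·log(1+t²) − (1/π)·∫₀^t log|s|/(1+s²) ds`. -/
noncomputable def etaF (t : ℝ) : ℝ :=
  Real.log (1 + t ^ 2) / 4 - (1 / Real.pi) * ∫ s in (0 : ℝ)..t, Real.log |s| / (1 + s ^ 2)

/-- The remainder term `r`. -/
noncomputable def rfun (x : ℝ) : ℝ :=
  (Real.sqrt 2 / (2 * Real.pi)) *
    ∫ t in Ioi (0 : ℝ), (t / (1 + t ^ 2)) * Real.exp (-etaF t) * Real.exp (-t * x)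

/-- The generalized eigenfunction `ψ₁`. -/
noncomputable def psiOne (x : ℝ) : ℝ :=
  if 0 < x then Real.sin (x + Real.pi / 8) - rfun x else 0

/-- The strip `|Im v| < π`. -/
def piStrip : Set ℂ := Complex.im ⁻¹' Ioo (-π) π

lemma isOpen_piStrip : IsOpen piStrip := isOpen_Ioo.preimage Complex.continuous_im

lemma convex_piStrip : Convex ℝ piStrip :=
  (convex_Ioo (-π) π).is_linear_preimage Complex.imLm.isLinear

lemma sinh_ne_zero_of_mem_piStrip {v : ℂ} (hv : v ∈ piStrip) (h0 : v ≠ 0) :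
    Complex.sinh v ≠ 0 := by
  intro h
  have h1 : Complex.sin (v * Complex.I) = 0 := by rw [Complex.sin_mul_I, h, zero_mul]
  obtain ⟨k, hk⟩ := Complex.sin_eq_zero_iff.1 h1
  have hre := congrArg Complex.re hk
  have him := congrArg Complex.im hk
  simp at hre him
  have hv' : -π < v.im ∧ v.im < π := hv
  have hk0 : k = 0 := by
    have hpi := Real.pi_pos
    have a1 : (k : ℝ) < 1 := by nlinarith
    have a2 : (-1 : ℝ) < k := by nlinarith
    have b1 : k < 1 := by exact_mod_cast a1
    have b2 : -1 < k := by exact_mod_cast a2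
    omega
  subst hk0
  exact h0 (Complex.ext him (by simpa using hre))

lemma one_add_exp_mem_slitPlane {v : ℂ} (hv : v ∈ piStrip) :
    1 + Complex.exp v ∈ Complex.slitPlane := by
  rw [Complex.mem_slitPlane_iff]
  by_contra! hcon
  obtain ⟨h1, h2⟩ := hcon
  simp only [Complex.add_re, Complex.one_re, Complex.add_im, Complex.one_im, zero_add,
    Complex.exp_re, Complex.exp_im] at h1 h2
  have hv' : -π < v.im ∧ v.im < π := hv
  have hs : Real.sin v.im = 0 := by
    rcases mul_eq_zero.1 h2 with h | h
    · exact absurd h (Real.exp_pos _).ne'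
    · exact h
  have hz := (Real.sin_eq_zero_iff_of_lt_of_lt hv'.1 hv'.2).1 hs
  rw [hz, Real.cos_zero] at h1
  linarith [Real.exp_pos v.re]

lemma norm_sinh_ge (v : ℂ) : |Real.sinh v.re| ≤ ‖Complex.sinh v‖ := by
  have h := abs_norm_sub_norm_le (Complex.exp v) (Complex.exp (-v))
  rw [Complex.norm_exp, Complex.norm_exp, Complex.neg_re] at h
  rw [Complex.sinh, Real.sinh_eq, norm_div, abs_div]
  simpa using div_le_div_of_nonneg_right h zero_le_two

/-- `sinh v / v`, extended by `1` at the origin. -/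
noncomputable def sinhc (v : ℂ) : ℂ := dslope Complex.sinh 0 v

lemma sinhc_zero : sinhc 0 = 1 := by
  simp [sinhc, dslope_same]

lemma sinhc_of_ne {v : ℂ} (hv : v ≠ 0) : sinhc v = Complex.sinh v / v := by
  simp [sinhc, dslope_of_ne _ hv, slope_def_field]

lemma sinhc_ne_zero {v : ℂ} (hv : v ∈ piStrip) : sinhc v ≠ 0 := by
  by_cases h : v = 0
  · simp [h, sinhc_zero]
  · rw [sinhc_of_ne h]
    exact div_ne_zero (sinh_ne_zero_of_mem_piStrip hv h) h

lemma zero_mem_piStrip : (0 : ℂ) ∈ piStrip := by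
  simp [piStrip, Real.pi_pos]

lemma differentiableOn_sinhc : DifferentiableOn ℂ sinhc piStrip :=
  (Complex.differentiableOn_dslope (isOpen_piStrip.mem_nhds zero_mem_piStrip)).2
    Complex.differentiable_sinh.differentiableOn

lemma exists_primitive_inv_sinhc :
    ∃ S : ℂ → ℂ, S 0 = 0 ∧ ∀ v ∈ piStrip, HasDerivAt S (sinhc v)⁻¹ v := by
  obtain ⟨g, hg⟩ := convex_piStrip.exists_forall_hasDerivWithinAt
    (differentiableOn_sinhc.inv fun v hv => sinhc_ne_zero hv)
  exact ⟨fun v => g v - g 0, sub_self _, fun v hv =>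
    ((hg v hv).hasDerivAt (isOpen_piStrip.mem_nhds hv)).sub_const _⟩

/-- The primitive of `v / sinh v` on the strip `|Im v| < π` vanishing at the origin. -/
noncomputable def sinhcPrim : ℂ → ℂ := Classical.choose exists_primitive_inv_sinhc

lemma sinhcPrim_zero : sinhcPrim 0 = 0 := (Classical.choose_spec exists_primitive_inv_sinhc).1

lemma hasDerivAt_sinhcPrim {v : ℂ} (hv : v ∈ piStrip) :
    HasDerivAt sinhcPrim (sinhc v)⁻¹ v :=
  (Classical.choose_spec exists_primitive_inv_sinhc).2 v hv

lemma add_mul_I_mem_piStrip {x y : ℝ} (hy : |y| ≤ π / 2) : (x + y * Complex.I : ℂ) ∈ piStrip := by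
  have := abs_le.1 hy
  have := Real.pi_pos
  simp [piStrip]
  constructor <;> linarith

lemma ofReal_mem_piStrip (x : ℝ) : (x : ℂ) ∈ piStrip := by
  simp [piStrip, Real.pi_pos]

lemma sinhcPrim_ofReal_im (x : ℝ) : (sinhcPrim x).im = 0 := by
  have hd (u : ℝ) : HasDerivAt (fun u : ℝ => (sinhcPrim u).im) 0 u := by
    have h := (hasDerivAt_sinhcPrim (ofReal_mem_piStrip u)).comp_ofReal
    have h2 : HasDerivAt (fun u : ℝ => (sinhcPrim u).im) ((sinhc u)⁻¹).im u :=
      Complex.imCLM.hasFDerivAt.comp_hasDerivAt u h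
    convert h2 using 1
    by_cases hu : u = 0
    · simp [hu, sinhc_zero]
    · rw [sinhc_of_ne (by exact_mod_cast hu), ← Complex.ofReal_sinh, ← Complex.ofReal_div,
        ← Complex.ofReal_inv, Complex.ofReal_im]
  have := is_const_of_deriv_eq_zero (fun u => (hd u).differentiableAt) (fun u => (hd u).deriv) x 0
  simpa [sinhcPrim_zero] using this

lemma sinhcPrim_mul_I_re {y : ℝ} (hy : y ∈ Ioo (-π) π) : (sinhcPrim (y * Complex.I)).re = 0 := by
  have hd (u : ℝ) (hu : u ∈ Ioo (-π) π) :
      HasDerivAt (fun u : ℝ => (sinhcPrim (u * Complex.I)).re) 0 u := by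
    have hm : (u * Complex.I : ℂ) ∈ piStrip := by simpa [piStrip] using hu
    have h0 : HasDerivAt (fun u : ℝ => (u * Complex.I : ℂ)) Complex.I u := by
      simpa using (Complex.ofRealCLM.hasDerivAt (x := u)).mul_const Complex.I
    have h := (hasDerivAt_sinhcPrim hm).comp u h0
    have h2 : HasDerivAt (fun u : ℝ => (sinhcPrim (u * Complex.I)).re)
        ((sinhc (u * Complex.I))⁻¹ * Complex.I).re u :=
      Complex.reCLM.hasFDerivAt.comp_hasDerivAt u h
    convert h2 using 1
    by_cases hu : u = 0
    · simp [hu, sinhc_zero]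
    · have hu' : (u : ℂ) ≠ 0 := by exact_mod_cast hu
      rw [sinhc_of_ne (mul_ne_zero hu' Complex.I_ne_zero), Complex.sinh_mul_I,
        mul_div_mul_right _ _ Complex.I_ne_zero, ← Complex.ofReal_sin, ← Complex.ofReal_div,
        ← Complex.ofReal_inv, Complex.re_ofReal_mul, Complex.I_re, mul_zero]
  have h0 : (0 : ℝ) ∈ Ioo (-π) π := by simp [Real.pi_pos]
  have := isOpen_Ioo.is_const_of_deriv_eq_zero isPreconnected_Ioo
    (fun u hu => (hd u hu).differentiableAt.differentiableWithinAt) (fun u hu => (hd u hu).deriv)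
    hy h0
  simpa [sinhcPrim_zero] using this

lemma exp_abs_div_four_le {x : ℝ} (hx : 1 ≤ |x|) : Real.exp |x| / 4 ≤ |Real.sinh x| := by
  rw [Real.abs_sinh, Real.sinh_eq]
  have h1 : Real.exp (-|x|) ≤ 1 := Real.exp_le_one_iff.2 (by linarith)
  have h2 := Real.add_one_le_exp |x|
  linarith

lemma norm_sinhcPrim_sub_le {x y : ℝ} (hy : |y| ≤ π / 2) (hx : 1 ≤ |x|) :
    ‖sinhcPrim (x + y * Complex.I) - sinhcPrim x‖ ≤ 2 * π * ((|x| + 2) * Real.exp (-|x|)) := by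
  have hpi := Real.pi_pos
  have hpi4 := Real.pi_le_four
  have hconv : Convex ℝ (({x} : Set ℝ) ×ℂ Icc (-(π / 2)) (π / 2)) :=
    ((convex_singleton x).is_linear_preimage Complex.reLm.isLinear).inter
      ((convex_Icc _ _).is_linear_preimage Complex.imLm.isLinear)
  have key := hconv.norm_image_sub_le_of_norm_hasDerivWithin_le (𝕜 := ℂ) (f := sinhcPrim)
    (f' := fun v => (sinhc v)⁻¹) (C := 4 * ((|x| + 2) * Real.exp (-|x|)))
    (x := x) (y := x + y * Complex.I) ?_ ?_ ?_ ?_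
  · refine key.trans ?_
    have : ‖(x + y * Complex.I - x : ℂ)‖ = |y| := by simp
    rw [this]
    have h3 : 0 ≤ (|x| + 2) * Real.exp (-|x|) := by positivity
    nlinarith
  · intro v hv
    refine (hasDerivAt_sinhcPrim ?_).hasDerivWithinAt
    have h := (Complex.mem_reProdIm.1 hv).2
    exact ⟨by linarith [h.1], by linarith [h.2]⟩
  · intro v hv
    obtain ⟨h1, h2, h3⟩ := Complex.mem_reProdIm.1 hv
    have h1 : v.re = x := h1
    have hv0 : v ≠ 0 := by
      rintro rfl
      simp at h1
      simp [← h1] at hx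
      linarith
    have hs := (exp_abs_div_four_le hx).trans (h1 ▸ norm_sinh_ge v)
    have hn : ‖v‖ ≤ |x| + 2 := by
      have := Complex.norm_le_abs_re_add_abs_im v
      rw [h1] at this
      have : |v.im| ≤ π / 2 := abs_le.2 ⟨h2, h3⟩
      linarith
    rw [sinhc_of_ne hv0, inv_div, norm_div, Real.exp_neg]
    calc ‖v‖ / ‖Complex.sinh v‖ ≤ (|x| + 2) / (Real.exp |x| / 4) := by gcongr
      _ = _ := by field_simp
  · exact Complex.mem_reProdIm.2 ⟨by simp, by simp; positivity⟩
  · exact Complex.mem_reProdIm.2 ⟨by simp, by simpa using abs_le.1 hy⟩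

lemma abs_sinhcPrim_im_le {x y : ℝ} (hy : |y| ≤ π / 2) (hx : 1 ≤ |x|) :
    |(sinhcPrim (x + y * Complex.I)).im| ≤ 2 * π * ((|x| + 2) * Real.exp (-|x|)) := by
  have h := (Complex.abs_im_le_norm _).trans (norm_sinhcPrim_sub_le hy hx)
  rwa [Complex.sub_im, sinhcPrim_ofReal_im, sub_zero] at h

lemma sinh_add_half_pi_mul_I (x : ℝ) :
    Complex.sinh (x + (π / 2 : ℝ) * Complex.I) = Complex.I * (Real.cosh x : ℝ) := by
  rw [Complex.sinh_add, Complex.sinh_mul_I, Complex.cosh_mul_I, ← Complex.ofReal_sin,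
    ← Complex.ofReal_cos, Real.sin_pi_div_two, Real.cos_pi_div_two, Complex.ofReal_cosh]
  simp [mul_comm]

lemma sinh_sub_half_pi_mul_I (x : ℝ) :
    Complex.sinh (x + (-(π / 2) : ℝ) * Complex.I) = -(Complex.I * (Real.cosh x : ℝ)) := by
  rw [Complex.sinh_add, Complex.sinh_mul_I, Complex.cosh_mul_I, ← Complex.ofReal_sin,
    ← Complex.ofReal_cos, Real.sin_neg, Real.cos_neg, Real.sin_pi_div_two, Real.cos_pi_div_two,
    Complex.ofReal_cosh]
  simp [mul_comm]

lemma inv_sinhc_add_half_pi (x : ℝ) :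
    (sinhc (x + (π / 2 : ℝ) * Complex.I))⁻¹ =
      (π / 2 / Real.cosh x : ℝ) + (-(x / Real.cosh x) : ℝ) * Complex.I := by
  have hne : (x + (π / 2 : ℝ) * Complex.I : ℂ) ≠ 0 := fun h => by
    have := congrArg Complex.im h
    simp [Real.pi_ne_zero] at this
  have hc : (Real.cosh x : ℂ) ≠ 0 := by exact_mod_cast (Real.cosh_pos x).ne'
  rw [sinhc_of_ne hne, inv_div, sinh_add_half_pi_mul_I,
    div_eq_iff (mul_ne_zero Complex.I_ne_zero hc)]
  push_cast [-Complex.ofReal_cosh]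
  field_simp
  linear_combination (2 * x : ℂ) * Complex.I_sq

lemma inv_sinhc_sub_half_pi (x : ℝ) :
    (sinhc (x + (-(π / 2) : ℝ) * Complex.I))⁻¹ =
      (π / 2 / Real.cosh x : ℝ) + (x / Real.cosh x : ℝ) * Complex.I := by
  have hne : (x + (-(π / 2) : ℝ) * Complex.I : ℂ) ≠ 0 := fun h => by
    have := congrArg Complex.im h
    simp [Real.pi_ne_zero] at this
  have hc : (Real.cosh x : ℂ) ≠ 0 := by exact_mod_cast (Real.cosh_pos x).ne'
  rw [sinhc_of_ne hne, inv_div, sinh_sub_half_pi_mul_I,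
    div_eq_iff (neg_ne_zero.2 (mul_ne_zero Complex.I_ne_zero hc))]
  push_cast [-Complex.ofReal_cosh]
  field_simp
  linear_combination (2 * x : ℂ) * Complex.I_sq

lemma abs_half_pi_le : |π / 2| ≤ π / 2 := (abs_of_pos (by positivity)).le

lemma abs_neg_half_pi_le : |-(π / 2)| ≤ π / 2 := by rw [abs_neg]; exact abs_half_pi_le

lemma hasDerivAt_sinhcPrim_line {y : ℝ} (hy : |y| ≤ π / 2) (x : ℝ) :
    HasDerivAt (fun u : ℝ => sinhcPrim (u + y * Complex.I)) (sinhc (x + y * Complex.I))⁻¹ x := by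
  have h0 : HasDerivAt (fun u : ℝ => (u + y * Complex.I : ℂ)) 1 x :=
    (Complex.ofRealCLM.hasDerivAt (x := x)).add_const _
  exact ((hasDerivAt_sinhcPrim (add_mul_I_mem_piStrip hy)).comp x h0).congr_deriv (mul_one _)

lemma exp_div_one_add_exp_sq (x : ℝ) :
    Real.exp x / (1 + Real.exp x ^ 2) = 1 / (2 * Real.cosh x) := by
  rw [Real.cosh_eq, Real.exp_neg]
  field_simp
  ring

lemma hasDerivAt_arctan_exp (x : ℝ) :
    HasDerivAt (fun u => Real.arctan (Real.exp u)) (1 / (2 * Real.cosh x)) x := by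
  refine (Real.hasDerivAt_exp x).arctan.congr_deriv ?_
  rw [← exp_div_one_add_exp_sq]
  ring

lemma eq_of_hasDerivAt_eq_of_eq {f g f' : ℝ → ℝ} (hf : ∀ x, HasDerivAt f (f' x) x)
    (hg : ∀ x, HasDerivAt g (f' x) x) (a : ℝ) (ha : f a = g a) (x : ℝ) : f x = g x := by
  have hd (u : ℝ) : HasDerivAt (fun u => f u - g u) 0 u :=
    ((hf u).sub (hg u)).congr_deriv (sub_self _)
  have := is_const_of_deriv_eq_zero (fun u => (hd u).differentiableAt) (fun u => (hd u).deriv) x a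
  linarith

lemma sinhcPrim_add_half_pi_re (x : ℝ) :
    (sinhcPrim (x + (π / 2 : ℝ) * Complex.I)).re = π * Real.arctan (Real.exp x) - π ^ 2 / 4 := by
  refine eq_of_hasDerivAt_eq_of_eq (f' := fun x => π / 2 / Real.cosh x)
    (f := fun x : ℝ => (sinhcPrim (x + (π / 2 : ℝ) * Complex.I)).re)
    (g := fun x => π * Real.arctan (Real.exp x) - π ^ 2 / 4) (fun u => ?_) (fun u => ?_) 0 ?_ x
  · have h : HasDerivAt (fun u : ℝ => (sinhcPrim (u + (π / 2 : ℝ) * Complex.I)).re)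
        ((sinhc (u + (π / 2 : ℝ) * Complex.I))⁻¹).re u :=
      Complex.reCLM.hasFDerivAt.comp_hasDerivAt u (hasDerivAt_sinhcPrim_line abs_half_pi_le u)
    rw [inv_sinhc_add_half_pi, Complex.add_re, Complex.ofReal_re, Complex.re_ofReal_mul,
      Complex.I_re, mul_zero, add_zero] at h
    exact h
  · refine (((hasDerivAt_arctan_exp u).const_mul π).sub_const (π ^ 2 / 4)).congr_deriv ?_
    field_simp
  · have h := sinhcPrim_mul_I_re (y := π / 2) ⟨by linarith [Real.pi_pos], by linarith [Real.pi_pos]⟩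
    simp only [Complex.ofReal_zero, zero_add, h, Real.exp_zero, Real.arctan_one]
    ring

lemma sinhcPrim_sub_half_pi_re (x : ℝ) :
    (sinhcPrim (x + (-(π / 2) : ℝ) * Complex.I)).re =
      π * Real.arctan (Real.exp x) - π ^ 2 / 4 := by
  refine eq_of_hasDerivAt_eq_of_eq (f' := fun x => π / 2 / Real.cosh x)
    (f := fun x : ℝ => (sinhcPrim (x + (-(π / 2) : ℝ) * Complex.I)).re)
    (g := fun x => π * Real.arctan (Real.exp x) - π ^ 2 / 4) (fun u => ?_) (fun u => ?_) 0 ?_ x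
  · have h : HasDerivAt (fun u : ℝ => (sinhcPrim (u + (-(π / 2) : ℝ) * Complex.I)).re)
        ((sinhc (u + (-(π / 2) : ℝ) * Complex.I))⁻¹).re u :=
      Complex.reCLM.hasFDerivAt.comp_hasDerivAt u (hasDerivAt_sinhcPrim_line abs_neg_half_pi_le u)
    rw [inv_sinhc_sub_half_pi, Complex.add_re, Complex.ofReal_re, Complex.re_ofReal_mul,
      Complex.I_re, mul_zero, add_zero] at h
    exact h
  · refine (((hasDerivAt_arctan_exp u).const_mul π).sub_const (π ^ 2 / 4)).congr_deriv ?_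
    field_simp
  · have h := sinhcPrim_mul_I_re (y := -(π / 2))
      ⟨by linarith [Real.pi_pos], by linarith [Real.pi_pos]⟩
    simp only [Complex.ofReal_zero, zero_add, h, Real.exp_zero, Real.arctan_one]
    ring

lemma hasDerivAt_sinhcPrim_add_half_pi_im (x : ℝ) :
    HasDerivAt (fun u : ℝ => (sinhcPrim (u + (π / 2 : ℝ) * Complex.I)).im)
      (-(x / Real.cosh x)) x := by
  have h : HasDerivAt (fun u : ℝ => (sinhcPrim (u + (π / 2 : ℝ) * Complex.I)).im)
      ((sinhc (x + (π / 2 : ℝ) * Complex.I))⁻¹).im x :=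
    Complex.imCLM.hasFDerivAt.comp_hasDerivAt x (hasDerivAt_sinhcPrim_line abs_half_pi_le x)
  rw [inv_sinhc_add_half_pi, Complex.add_im, Complex.ofReal_im, Complex.im_ofReal_mul,
    Complex.I_im, mul_one, zero_add] at h
  exact h

lemma tendsto_add_two_mul_exp_neg :
    Filter.Tendsto (fun u : ℝ => (u + 2) * Real.exp (-u)) Filter.atTop (nhds 0) := by
  have h1 := Real.tendsto_pow_mul_exp_neg_atTop_nhds_zero 1
  have h0 := (Real.tendsto_pow_mul_exp_neg_atTop_nhds_zero 0).const_mul 2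
  have := h1.add h0
  simp only [pow_one, pow_zero, one_mul, mul_zero, add_zero] at this
  refine this.congr fun u => by ring

lemma tendsto_sinhcPrim_add_half_pi_im {l : Filter ℝ} (hl : Filter.Tendsto (|·|) l Filter.atTop) :
    Filter.Tendsto (fun x : ℝ => (sinhcPrim (x + (π / 2 : ℝ) * Complex.I)).im) l (nhds 0) := by
  refine squeeze_zero_norm' (a := fun x => 2 * π * ((|x| + 2) * Real.exp (-|x|))) ?_ ?_
  · filter_upwards [hl.eventually_ge_atTop 1] with x hx
    exact abs_sinhcPrim_im_le abs_half_pi_le hx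
  · simpa using ((tendsto_add_two_mul_exp_neg.comp hl).const_mul (2 * π))

lemma sinhcPrim_add_half_pi_im_nonneg (x : ℝ) :
    0 ≤ (sinhcPrim (x + (π / 2 : ℝ) * Complex.I)).im := by
  have hd := hasDerivAt_sinhcPrim_add_half_pi_im
  have hcont : Continuous (fun u : ℝ => (sinhcPrim (u + (π / 2 : ℝ) * Complex.I)).im) :=
    continuous_iff_continuousAt.2 fun u => (hd u).continuousAt
  rcases le_total x 0 with hx | hx
  · have hmono : MonotoneOn
        (fun u : ℝ => (sinhcPrim (u + (π / 2 : ℝ) * Complex.I)).im) (Iic 0) := by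
      refine monotoneOn_of_hasDerivWithinAt_nonneg (convex_Iic 0) hcont.continuousOn
        (fun u _ => (hd u).hasDerivWithinAt) fun u hu => ?_
      rw [interior_Iic] at hu
      have := Real.cosh_pos u
      rw [← neg_div]
      exact div_nonneg (by linarith [mem_Iio.1 hu]) this.le
    refine le_of_tendsto (tendsto_sinhcPrim_add_half_pi_im Filter.tendsto_abs_atBot_atTop) ?_
    filter_upwards [Filter.eventually_le_atBot x] with u hu
    exact hmono (hu.trans hx) hx hu
  · have hanti : AntitoneOn
        (fun u : ℝ => (sinhcPrim (u + (π / 2 : ℝ) * Complex.I)).im) (Ici 0) := by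
      refine antitoneOn_of_hasDerivWithinAt_nonpos (convex_Ici 0) hcont.continuousOn
        (fun u _ => (hd u).hasDerivWithinAt) fun u hu => ?_
      rw [interior_Ici] at hu
      have := Real.cosh_pos u
      exact neg_nonpos.2 (div_nonneg (mem_Ioi.1 hu).le this.le)
    refine le_of_tendsto (tendsto_sinhcPrim_add_half_pi_im Filter.tendsto_abs_atTop_atTop) ?_
    filter_upwards [Filter.eventually_ge_atTop x] with u hu
    exact hanti hx (hx.trans hu) hu

lemma intervalIntegrable_log_abs_div (a b : ℝ) :
    IntervalIntegrable (fun s : ℝ => Real.log |s| / (1 + s ^ 2)) volume a b := by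
  simp only [Real.log_abs, div_eq_mul_inv]
  refine intervalIntegral.intervalIntegrable_log'.mul_continuousOn ?_
  exact (Continuous.inv₀ (by fun_prop) fun s => by positivity).continuousOn

lemma hasDerivAt_integral_log_abs_div_exp (x : ℝ) :
    HasDerivAt (fun u : ℝ => ∫ s in (0 : ℝ)..Real.exp u, Real.log |s| / (1 + s ^ 2))
      (x / (2 * Real.cosh x)) x := by
  have hcont : ContinuousOn (fun s : ℝ => Real.log |s| / (1 + s ^ 2)) (Ioi 0) := by
    refine ContinuousOn.div ?_ (by fun_prop) fun s _ => by positivity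
    simp only [Real.log_abs]
    exact Real.continuousOn_log.mono fun s hs => (mem_Ioi.1 hs).ne'
  have h := intervalIntegral.integral_hasDerivAt_right
    (intervalIntegrable_log_abs_div 0 (Real.exp x))
    (hcont.stronglyMeasurableAtFilter isOpen_Ioi _ (Real.exp_pos x))
    (hcont.continuousAt (Ioi_mem_nhds (Real.exp_pos x)))
  refine (h.comp x (Real.hasDerivAt_exp x)).congr_deriv ?_
  rw [abs_of_pos (Real.exp_pos x), Real.log_exp, mul_comm_div, exp_div_one_add_exp_sq]
  ring

lemma sinhcPrim_add_half_pi_im (x : ℝ) :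
    (sinhcPrim (x + (π / 2 : ℝ) * Complex.I)).im =
      -2 * ∫ s in (0 : ℝ)..Real.exp x, Real.log |s| / (1 + s ^ 2) := by
  set F := fun u : ℝ => (sinhcPrim (u + (π / 2 : ℝ) * Complex.I)).im +
    2 * ∫ s in (0 : ℝ)..Real.exp u, Real.log |s| / (1 + s ^ 2) with hF
  have hd (u : ℝ) : HasDerivAt F 0 u := by
    refine ((hasDerivAt_sinhcPrim_add_half_pi_im u).add
      ((hasDerivAt_integral_log_abs_div_exp u).const_mul 2)).congr_deriv ?_
    have := (Real.cosh_pos u).ne'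
    field_simp
    ring
  have hconst (u : ℝ) : F u = F x :=
    is_const_of_deriv_eq_zero (fun u => (hd u).differentiableAt) (fun u => (hd u).deriv) u x
  have hlim : Filter.Tendsto F Filter.atBot (nhds 0) := by
    have h1 := tendsto_sinhcPrim_add_half_pi_im Filter.tendsto_abs_atBot_atTop
    have h2 : Filter.Tendsto
        (fun u => ∫ s in (0 : ℝ)..Real.exp u, Real.log |s| / (1 + s ^ 2)) Filter.atBot
        (nhds 0) := by
      have := (intervalIntegral.continuous_primitive intervalIntegrable_log_abs_div 0).tendsto 0
      rw [intervalIntegral.integral_same] at this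
      exact this.comp Real.tendsto_exp_atBot
    have h3 := h1.add (h2.const_mul 2)
    rwa [mul_zero, add_zero] at h3
  have h0 : F x = 0 :=
    tendsto_nhds_unique (tendsto_const_nhds.congr fun u => (hconst u).symm) hlim
  simp only [hF] at h0
  linarith

lemma etaF_exp (x : ℝ) :
    etaF (Real.exp x) = Real.log (1 + Real.exp x ^ 2) / 4 +
      (sinhcPrim (x + (π / 2 : ℝ) * Complex.I)).im / (2 * π) := by
  rw [sinhcPrim_add_half_pi_im, etaF]
  have := Real.pi_ne_zero
  field_simp
  ring

lemma log_one_add_mul_I (t : ℝ) :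
    Complex.log (1 + t * Complex.I) =
      (Real.log (1 + t ^ 2) / 2 : ℝ) + (Real.arctan t : ℝ) * Complex.I := by
  have hn : ‖(1 + t * Complex.I : ℂ)‖ = √(1 + t ^ 2) := by
    have := Complex.norm_add_mul_I 1 t
    simpa using this
  apply Complex.ext
  · rw [Complex.log_re, hn, Real.log_sqrt (by positivity)]
    simp [-Complex.ofReal_arctan]
  · rw [Complex.log_im, Complex.arg_of_re_nonneg (by simp), hn, Real.arctan_eq_arcsin]
    simp

/-- The logarithm of `whFactor`. -/
noncomputable def whExponent (v : ℂ) : ℂ :=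
  (1 / 2 : ℝ) * Complex.log (1 + Complex.exp v) +
    (1 / (2 * π) : ℝ) * (Complex.I * sinhcPrim v) + (π / 8 : ℝ) * Complex.I

/-- The holomorphic extension of the reciprocal of `t ↦ exp (-η t)` to the upper half-plane,
in the coordinate `v` with `t = I * exp v`. -/
noncomputable def whFactor (v : ℂ) : ℂ := Complex.exp (whExponent v)

lemma whExponent_re (v : ℂ) : (whExponent v).re =
    1 / 2 * (Complex.log (1 + Complex.exp v)).re - (sinhcPrim v).im / (2 * π) := by
  simp only [whExponent, Complex.add_re, Complex.re_ofReal_mul, Complex.I_mul_re, Complex.I_re,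
    mul_zero, add_zero]
  ring

lemma whExponent_im (v : ℂ) : (whExponent v).im =
    1 / 2 * (Complex.log (1 + Complex.exp v)).im + (sinhcPrim v).re / (2 * π) + π / 8 := by
  simp only [whExponent, Complex.add_im, Complex.im_ofReal_mul, Complex.I_mul_im, Complex.I_im]
  ring

lemma differentiableOn_whFactor : DifferentiableOn ℂ whFactor piStrip := by
  intro v hv
  have h1 : DifferentiableAt ℂ (fun v => Complex.log (1 + Complex.exp v)) v :=
    (Complex.differentiableAt_exp.const_add 1).clog (one_add_exp_mem_slitPlane hv)
  have h2 := (hasDerivAt_sinhcPrim hv).differentiableAt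
  exact (((h1.const_mul _).add ((h2.const_mul _).const_mul _)).add_const _).cexp
    |>.differentiableWithinAt

lemma whFactor_zero_im : (whFactor 0).im = √2 * Real.sin (π / 8) := by
  have h : Complex.log (1 + Complex.exp 0) = (Real.log 2 : ℝ) := by
    rw [Complex.exp_zero, Complex.ofReal_log zero_le_two]
    norm_num
  rw [whFactor, Complex.exp_im, whExponent_re, whExponent_im, h, sinhcPrim_zero]
  simp only [Complex.ofReal_re, Complex.ofReal_im, Complex.zero_im, Complex.zero_re]
  rw [Real.sqrt_eq_rpow, Real.rpow_def_of_pos zero_lt_two]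
  ring_nf

lemma exp_add_half_pi_mul_I (x : ℝ) :
    Complex.exp (x + (π / 2 : ℝ) * Complex.I) = (Real.exp x : ℝ) * Complex.I := by
  rw [Complex.exp_add, Complex.ofReal_exp]
  push_cast
  rw [Complex.exp_pi_div_two_mul_I]

lemma exp_sub_half_pi_mul_I (x : ℝ) :
    Complex.exp (x + (-(π / 2) : ℝ) * Complex.I) = (-Real.exp x : ℝ) * Complex.I := by
  rw [Complex.exp_add]
  push_cast
  rw [neg_mul, Complex.exp_neg, Complex.exp_pi_div_two_mul_I, Complex.inv_I]
  ring

lemma log_one_add_exp_add_half_pi (x : ℝ) :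
    Complex.log (1 + Complex.exp (x + (π / 2 : ℝ) * Complex.I)) =
      (Real.log (1 + Real.exp x ^ 2) / 2 : ℝ) + (Real.arctan (Real.exp x) : ℝ) * Complex.I := by
  rw [exp_add_half_pi_mul_I, log_one_add_mul_I]

lemma log_one_add_exp_sub_half_pi (x : ℝ) :
    Complex.log (1 + Complex.exp (x + (-(π / 2) : ℝ) * Complex.I)) =
      (Real.log (1 + Real.exp x ^ 2) / 2 : ℝ) + (-Real.arctan (Real.exp x) : ℝ) * Complex.I := by
  rw [exp_sub_half_pi_mul_I, log_one_add_mul_I, neg_sq, Real.arctan_neg]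

lemma whFactor_add_half_pi_im (x : ℝ) :
    (whFactor (x + (π / 2 : ℝ) * Complex.I)).im =
      Real.exp x * Real.exp (-etaF (Real.exp x)) := by
  have hpi := Real.pi_ne_zero
  have hre : (whExponent (x + (π / 2 : ℝ) * Complex.I)).re =
      Real.log (√(1 + Real.exp x ^ 2)) - etaF (Real.exp x) := by
    rw [whExponent_re, log_one_add_exp_add_half_pi, etaF_exp, Real.log_sqrt (by positivity)]
    simp only [Complex.add_re, Complex.ofReal_re, Complex.re_ofReal_mul, Complex.I_re, mul_zero,
      add_zero]
    ring
  have him : (whExponent (x + (π / 2 : ℝ) * Complex.I)).im = Real.arctan (Real.exp x) := by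
    rw [whExponent_im, log_one_add_exp_add_half_pi, sinhcPrim_add_half_pi_re]
    simp only [Complex.add_im, Complex.ofReal_im, Complex.im_ofReal_mul, Complex.I_im, mul_one,
      zero_add]
    field_simp
    ring
  have hs : 0 < √(1 + Real.exp x ^ 2) := by positivity
  rw [whFactor, Complex.exp_im, hre, him, sub_eq_add_neg, Real.exp_add, Real.exp_log hs,
    Real.sin_arctan]
  field_simp

lemma whFactor_sub_half_pi_im (x : ℝ) :
    (whFactor (x + (-(π / 2) : ℝ) * Complex.I)).im = 0 := by
  have hpi := Real.pi_ne_zero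
  have him : (whExponent (x + (-(π / 2) : ℝ) * Complex.I)).im = 0 := by
    rw [whExponent_im, log_one_add_exp_sub_half_pi, sinhcPrim_sub_half_pi_re]
    simp only [Complex.add_im, Complex.ofReal_im, Complex.im_ofReal_mul, Complex.I_im, mul_one,
      zero_add]
    field_simp
    ring
  rw [whFactor, Complex.exp_im, him, Real.sin_zero, mul_zero]

lemma norm_whFactor_le {x y : ℝ} (hy : |y| ≤ π / 2) (hx : 1 ≤ |x|) :
    ‖whFactor (x + y * Complex.I)‖ ≤ Real.exp (|x| / 2 + 5 / 2) := by
  have hpi := Real.pi_pos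
  rw [whFactor, Complex.norm_exp, Real.exp_le_exp, whExponent_re, Complex.log_re]
  have h0 : 0 < ‖(1 + Complex.exp (x + y * Complex.I) : ℂ)‖ :=
    norm_pos_iff.2 (Complex.slitPlane_ne_zero
      (one_add_exp_mem_slitPlane (add_mul_I_mem_piStrip hy)))
  have h1 : ‖(1 + Complex.exp (x + y * Complex.I) : ℂ)‖ ≤ Real.exp (1 + |x|) := by
    refine (norm_add_le _ _).trans ?_
    rw [Complex.norm_exp, norm_one, Complex.add_re, Complex.ofReal_re, Complex.re_ofReal_mul,
      Complex.I_re, mul_zero, add_zero]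
    have a1 : Real.exp x ≤ Real.exp |x| := Real.exp_le_exp.2 (le_abs_self x)
    have a2 : 1 ≤ Real.exp |x| := Real.one_le_exp (abs_nonneg x)
    have a3 := Real.add_one_le_exp (1 : ℝ)
    rw [Real.exp_add]
    nlinarith
  have h2 := (Real.log_le_iff_le_exp h0).2 h1
  have h3 : -(sinhcPrim (x + y * Complex.I)).im / (2 * π) ≤ 2 := by
    rw [div_le_iff₀ (by positivity)]
    have b1 := (neg_le_abs _).trans (abs_sinhcPrim_im_le hy hx)
    have b2 : (|x| + 2) * Real.exp (-|x|) ≤ 2 := by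
      rw [Real.exp_neg, ← div_eq_mul_inv, div_le_iff₀ (Real.exp_pos _)]
      have := Real.add_one_le_exp |x|
      linarith
    nlinarith
  rw [neg_div] at h3
  linarith

/-- The function `(whFactor v - whFactor 0) / (2 * I * sinh v)` with its removable singularity
at the origin removed. -/
noncomputable def whKernel (v : ℂ) : ℂ := dslope whFactor 0 v / (2 * Complex.I * sinhc v)

lemma whKernel_of_ne {v : ℂ} (hv : v ≠ 0) :
    whKernel v = (whFactor v - whFactor 0) / (2 * Complex.I * Complex.sinh v) := by
  rw [whKernel, sinhc_of_ne hv, dslope_of_ne _ hv, slope_def_field, sub_zero, mul_div_assoc',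
    div_div_div_cancel_right₀ hv]

lemma differentiableOn_whKernel : DifferentiableOn ℂ whKernel piStrip := by
  refine DifferentiableOn.div ?_ (differentiableOn_sinhc.const_mul _) fun v hv =>
    mul_ne_zero (mul_ne_zero two_ne_zero Complex.I_ne_zero) (sinhc_ne_zero hv)
  exact (Complex.differentiableOn_dslope (isOpen_piStrip.mem_nhds zero_mem_piStrip)).2
    differentiableOn_whFactor

lemma add_mul_I_ne_zero_of_im {x y : ℝ} (h : y ≠ 0) : (x + y * Complex.I : ℂ) ≠ 0 := fun h0 => by
  have := congrArg Complex.im h0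
  simp at this
  exact h this

lemma whKernel_add_half_pi_im (x : ℝ) :
    (whKernel (x + (π / 2 : ℝ) * Complex.I)).im =
      -((Real.exp x * Real.exp (-etaF (Real.exp x)) - √2 * Real.sin (π / 8)) /
        (2 * Real.cosh x)) := by
  rw [whKernel_of_ne (add_mul_I_ne_zero_of_im (by positivity)), sinh_add_half_pi_mul_I]
  have : (2 * Complex.I * (Complex.I * (Real.cosh x : ℝ)) : ℂ) = (-(2 * Real.cosh x) : ℝ) := by
    push_cast
    linear_combination (2 * Complex.cosh x) * Complex.I_sq
  rw [this, Complex.div_ofReal_im, Complex.sub_im, whFactor_add_half_pi_im, whFactor_zero_im,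
    div_neg]

lemma whKernel_sub_half_pi_im (x : ℝ) :
    (whKernel (x + (-(π / 2) : ℝ) * Complex.I)).im =
      -(√2 * Real.sin (π / 8) / (2 * Real.cosh x)) := by
  rw [whKernel_of_ne (add_mul_I_ne_zero_of_im (neg_ne_zero.2 (by positivity))),
    sinh_sub_half_pi_mul_I]
  have : (2 * Complex.I * -(Complex.I * (Real.cosh x : ℝ)) : ℂ) = (2 * Real.cosh x : ℝ) := by
    push_cast
    linear_combination (-2 * Complex.cosh x) * Complex.I_sq
  rw [this, Complex.div_ofReal_im, Complex.sub_im, whFactor_sub_half_pi_im, whFactor_zero_im,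
    zero_sub, neg_div]

lemma norm_whKernel_le {x y : ℝ} (hy : |y| ≤ π / 2) (hx : 1 ≤ |x|) :
    ‖whKernel (x + y * Complex.I)‖ ≤
      (Real.exp (|x| / 2 + 5 / 2) + ‖whFactor 0‖) / (2 * (Real.exp |x| / 4)) := by
  have hne : (x + y * Complex.I : ℂ) ≠ 0 := fun h0 => by
    have := congrArg Complex.re h0
    simp at this
    rw [this, abs_zero] at hx
    linarith
  have hs : Real.exp |x| / 4 ≤ ‖Complex.sinh (x + y * Complex.I)‖ := by
    have := norm_sinh_ge (x + y * Complex.I)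
    simp only [Complex.add_re, Complex.ofReal_re, Complex.re_ofReal_mul, Complex.I_re, mul_zero,
      add_zero] at this
    exact (exp_abs_div_four_le hx).trans this
  rw [whKernel_of_ne hne, norm_div, norm_mul, norm_mul, Complex.norm_I, mul_one, Complex.norm_two]
  gcongr
  exact (norm_sub_le _ _).trans (by gcongr; exact norm_whFactor_le hy hx)

lemma continuous_whKernel_line {y : ℝ} (hy : |y| ≤ π / 2) :
    Continuous fun x : ℝ => whKernel (x + y * Complex.I) :=
  differentiableOn_whKernel.continuousOn.comp_continuous (by fun_prop) fun _ =>
    add_mul_I_mem_piStrip hy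

lemma norm_integral_whKernel_vertical_le {x R : ℝ} (hR : 1 ≤ R) (hx : |x| = R) :
    ‖∫ y : ℝ in (-(π / 2))..(π / 2), whKernel (x + y * Complex.I)‖ ≤
      (Real.exp (R / 2 + 5 / 2) + ‖whFactor 0‖) / (2 * (Real.exp R / 4)) * π := by
  have h := intervalIntegral.norm_integral_le_of_norm_le_const (a := -(π / 2)) (b := π / 2)
    (f := fun y : ℝ => whKernel (x + y * Complex.I))
    (C := (Real.exp (R / 2 + 5 / 2) + ‖whFactor 0‖) / (2 * (Real.exp R / 4))) fun y hy => by
      rw [uIoc_of_le (by linarith [Real.pi_pos])] at hy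
      have := norm_whKernel_le (x := x) (y := y) (abs_le.2 ⟨hy.1.le, hy.2⟩) (hx ▸ hR)
      rwa [hx] at this
  convert h using 2
  rw [abs_of_pos] <;> linarith [Real.pi_pos]

lemma abs_integral_whKernel_im_le {R : ℝ} (hR : 1 ≤ R) :
    |∫ x in (-R)..R, ((whKernel (x + (-(π / 2) : ℝ) * Complex.I)).im -
        (whKernel (x + (π / 2 : ℝ) * Complex.I)).im)| ≤
      2 * ((Real.exp (R / 2 + 5 / 2) + ‖whFactor 0‖) / (2 * (Real.exp R / 4)) * π) := by
  have hrect := Complex.integral_boundary_rect_eq_zero_of_differentiableOn whKernel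
    (⟨-R, -(π / 2)⟩ : ℂ) ⟨R, π / 2⟩ (differentiableOn_whKernel.mono fun v hv => by
      have h := (Complex.mem_reProdIm.1 hv).2
      simp only [uIcc_of_le (show -(π / 2) ≤ π / 2 by linarith [Real.pi_pos])] at h
      exact ⟨by linarith [h.1, Real.pi_pos], by linarith [h.2, Real.pi_pos]⟩)
  simp only at hrect
  have hc1 := continuous_whKernel_line abs_neg_half_pi_le
  have hc2 := continuous_whKernel_line abs_half_pi_le
  have him : (∫ x in (-R)..R, ((whKernel (x + (-(π / 2) : ℝ) * Complex.I)).im -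
        (whKernel (x + (π / 2 : ℝ) * Complex.I)).im)) =
      (∫ x in (-R)..R, (whKernel (x + (-(π / 2) : ℝ) * Complex.I) -
        whKernel (x + (π / 2 : ℝ) * Complex.I))).im :=
    Complex.imCLM.intervalIntegral_comp_comm ((hc1.sub hc2).intervalIntegrable _ _)
  rw [him, intervalIntegral.integral_sub (hc1.intervalIntegrable _ _) (hc2.intervalIntegrable _ _)]
  refine (Complex.abs_im_le_norm _).trans ?_
  have v1 := norm_integral_whKernel_vertical_le hR (abs_of_nonneg (by linarith : 0 ≤ R))
  have v2 := norm_integral_whKernel_vertical_le (x := -R) hR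
    (by rw [abs_neg, abs_of_nonneg (by linarith)])
  set V1 := ∫ y : ℝ in (-(π / 2))..(π / 2), whKernel (R + y * Complex.I)
  set V2 := ∫ y : ℝ in (-(π / 2))..(π / 2), whKernel ((-R : ℝ) + y * Complex.I)
  have heq := eq_neg_of_add_eq_zero_left ((add_sub_assoc _ _ _).symm.trans hrect)
  rw [heq, norm_neg, two_mul]
  refine (norm_sub_le _ _).trans (add_le_add ?_ ?_)
  · simpa [norm_smul] using v1
  · simpa [norm_smul] using v2

lemma tendsto_integral_whKernel_im :
    Filter.Tendsto (fun R : ℝ => ∫ x in (-R)..R,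
      ((whKernel (x + (-(π / 2) : ℝ) * Complex.I)).im -
        (whKernel (x + (π / 2 : ℝ) * Complex.I)).im)) Filter.atTop (nhds 0) := by
  refine squeeze_zero_norm' (Filter.eventually_ge_atTop 1 |>.mono fun R hR =>
    abs_integral_whKernel_im_le hR) ?_
  have h1 : Filter.Tendsto (fun R : ℝ => Real.exp (-R)) Filter.atTop (nhds 0) :=
    Real.tendsto_exp_neg_atTop_nhds_zero
  have h2 : Filter.Tendsto (fun R : ℝ => Real.exp (-(R / 2))) Filter.atTop (nhds 0) :=
    h1.comp (Filter.tendsto_id.atTop_div_const two_pos)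
  have h3 := ((h2.const_mul (Real.exp (5 / 2))).add (h1.const_mul ‖whFactor 0‖)).const_mul (4 * π)
  simp only [mul_zero, add_zero] at h3
  refine h3.congr fun R => ?_
  rw [Real.exp_add, Real.exp_neg, Real.exp_neg]
  have : Real.exp R = Real.exp (R / 2) ^ 2 := by rw [← Real.exp_nat_mul]; congr 1; ring
  rw [this]
  field_simp

/-- The density of the measure whose Laplace transform is proportional to `rfun`. -/
noncomputable def rDensity (t : ℝ) : ℝ := t / (1 + t ^ 2) * Real.exp (-etaF t)

lemma continuous_rDensity : Continuous rDensity := by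
  have h := intervalIntegral.continuous_primitive intervalIntegrable_log_abs_div 0
  have h2 : Continuous fun t : ℝ => Real.log (1 + t ^ 2) :=
    Continuous.log (by fun_prop) fun t => by positivity
  have h3 : Continuous fun t : ℝ => t / (1 + t ^ 2) :=
    continuous_id.div (by fun_prop) fun t => by positivity
  exact h3.mul (Real.continuous_exp.comp ((h2.div_const 4).sub (h.const_mul (1 / π))).neg)

lemma rDensity_nonneg {t : ℝ} (ht : 0 ≤ t) : 0 ≤ rDensity t := by
  unfold rDensity
  positivity

lemma rDensity_exp_mul_exp (x : ℝ) :
    rDensity (Real.exp x) * Real.exp x =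
      (whKernel (x + (-(π / 2) : ℝ) * Complex.I)).im -
        (whKernel (x + (π / 2 : ℝ) * Complex.I)).im +
        √2 * Real.sin (π / 8) * 2 * (1 / (2 * Real.cosh x)) := by
  rw [whKernel_add_half_pi_im, whKernel_sub_half_pi_im, rDensity, exp_div_one_add_exp_sq]
  ring

lemma integral_rDensity_exp (R : ℝ) :
    ∫ t in Real.exp (-R)..Real.exp R, rDensity t =
      (∫ x in (-R)..R, ((whKernel (x + (-(π / 2) : ℝ) * Complex.I)).im -
        (whKernel (x + (π / 2 : ℝ) * Complex.I)).im)) +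
        √2 * Real.sin (π / 8) * 2 *
          (Real.arctan (Real.exp R) - Real.arctan (Real.exp (-R))) := by
  have hc1 := Complex.continuous_im.comp (continuous_whKernel_line abs_neg_half_pi_le)
  have hc2 := Complex.continuous_im.comp (continuous_whKernel_line abs_half_pi_le)
  have hc3 : Continuous fun x : ℝ => 1 / (2 * Real.cosh x) :=
    continuous_const.div (by fun_prop) fun x => by positivity
  have hch := intervalIntegral.integral_comp_mul_deriv (a := -R) (b := R) (f := Real.exp)
    (f' := Real.exp) (g := rDensity) (fun x _ => Real.hasDerivAt_exp x)
    Real.continuous_exp.continuousOn continuous_rDensity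
  have hat : ∫ x in (-R)..R, 1 / (2 * Real.cosh x) =
      Real.arctan (Real.exp R) - Real.arctan (Real.exp (-R)) :=
    intervalIntegral.integral_eq_sub_of_hasDerivAt (fun x _ => hasDerivAt_arctan_exp x)
      (hc3.intervalIntegrable _ _)
  rw [← hch, ← hat, ← intervalIntegral.integral_const_mul]
  exact (intervalIntegral.integral_congr fun x _ => rDensity_exp_mul_exp x).trans
    (intervalIntegral.integral_add ((hc1.sub hc2).intervalIntegrable _ _)
      ((hc3.const_mul _).intervalIntegrable _ _))

lemma tendsto_integral_rDensity :
    Filter.Tendsto (fun R : ℝ => ∫ t in Real.exp (-R)..Real.exp R, rDensity t) Filter.atTop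
      (nhds (√2 * Real.sin (π / 8) * π)) := by
  have h1 : Filter.Tendsto (fun R => Real.arctan (Real.exp R)) Filter.atTop (nhds (π / 2)) :=
    (Real.tendsto_arctan_atTop.mono_right nhdsWithin_le_nhds).comp Real.tendsto_exp_atTop
  have h2 : Filter.Tendsto (fun R => Real.arctan (Real.exp (-R))) Filter.atTop (nhds 0) := by
    have := (Real.continuous_arctan.tendsto 0).comp Real.tendsto_exp_neg_atTop_nhds_zero
    rwa [Real.arctan_zero] at this
  have h3 := tendsto_integral_whKernel_im.add
    ((h1.sub h2).const_mul (√2 * Real.sin (π / 8) * 2))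
  simp only [← integral_rDensity_exp] at h3
  convert h3 using 2
  ring

lemma integrableOn_rDensity_and_integral :
    IntegrableOn rDensity (Ioi 0) ∧
      ∫ t in Ioi (0 : ℝ), rDensity t = √2 * Real.sin (π / 8) * π := by
  have hcover : AECover (volume.restrict (Ioi (0 : ℝ))) Filter.atTop
      (fun R : ℝ => Ioc (Real.exp (-R)) (Real.exp R)) := by
    refine ⟨(ae_restrict_mem measurableSet_Ioi).mono fun t ht => ?_, fun _ => measurableSet_Ioc⟩
    filter_upwards [Real.tendsto_exp_neg_atTop_nhds_zero.eventually_lt_const ht,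
      Real.tendsto_exp_atTop.eventually_ge_atTop t] with R h1 h2
    exact ⟨h1, h2⟩
  have hint (R : ℝ) : IntegrableOn rDensity (Ioc (Real.exp (-R)) (Real.exp R))
      (volume.restrict (Ioi 0)) :=
    ((continuous_rDensity.integrableOn_Icc).mono_set Ioc_subset_Icc_self).mono_measure
      Measure.restrict_le_self
  have hnn : 0 ≤ᵐ[volume.restrict (Ioi (0 : ℝ))] rDensity :=
    (ae_restrict_mem measurableSet_Ioi).mono fun t ht => rDensity_nonneg (le_of_lt ht)
  have hlim : Filter.Tendsto (fun R : ℝ => ∫ t in Ioc (Real.exp (-R)) (Real.exp R), rDensity t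
      ∂(volume.restrict (Ioi 0))) Filter.atTop (nhds (√2 * Real.sin (π / 8) * π)) := by
    refine tendsto_integral_rDensity.congr' ?_
    filter_upwards [Filter.eventually_ge_atTop 0] with R hR
    rw [intervalIntegral.integral_of_le (Real.exp_le_exp.2 (by linarith)),
      Measure.restrict_restrict measurableSet_Ioc, inter_eq_left.2]
    exact fun t ht => (Real.exp_pos _).trans ht.1
  exact ⟨hcover.integrable_of_integral_tendsto_of_nonneg_ae _ hint hnn hlim,
    hcover.integral_eq_of_tendsto_of_nonneg_ae _ hnn hint hlim⟩

lemma exp_neg_etaF_le {t : ℝ} (ht : 0 < t) : Real.exp (-etaF t) ≤ (√t)⁻¹ := by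
  have h : Real.log t / 2 ≤ etaF t := by
    have h1 := etaF_exp (Real.log t)
    rw [Real.exp_log ht] at h1
    have h2 : 0 ≤ (sinhcPrim (Real.log t + (π / 2 : ℝ) * Complex.I)).im / (2 * π) :=
      div_nonneg (sinhcPrim_add_half_pi_im_nonneg _) (by positivity)
    have h3 : Real.log (t ^ 2) ≤ Real.log (1 + t ^ 2) :=
      Real.log_le_log (by positivity) (by linarith)
    rw [Real.log_pow] at h3
    push_cast at h3
    linarith
  rw [Real.exp_neg, ← Real.exp_log (Real.sqrt_pos.2 ht), Real.log_sqrt ht.le]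
  gcongr

lemma rDensity_le {t : ℝ} (ht : 0 < t) : rDensity t ≤ t ^ (-(3 / 2) : ℝ) := by
  have h1 : t / (1 + t ^ 2) ≤ t⁻¹ := by
    rw [div_le_iff₀ (by positivity), inv_mul_eq_div, le_div_iff₀ ht]
    nlinarith
  have h2 : t ^ (-(3 / 2) : ℝ) = t⁻¹ * (√t)⁻¹ := by
    rw [← Real.rpow_neg_one, Real.sqrt_eq_rpow, ← Real.rpow_neg ht.le, ← Real.rpow_add ht]
    norm_num
  rw [h2, rDensity]
  exact mul_le_mul h1 (exp_neg_etaF_le ht) (Real.exp_pos _).le (by positivity)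

lemma one_sub_exp_neg_mul_mem_Icc {t x : ℝ} (ht : 0 ≤ t) (hx : 0 ≤ x) :
    1 - Real.exp (-t * x) ∈ Icc 0 (min 1 (t * x)) := by
  have h1 : Real.exp (-t * x) ≤ 1 := Real.exp_le_one_iff.2 (by nlinarith [mul_nonneg ht hx])
  have h2 := Real.add_one_le_exp (-t * x)
  have h3 := Real.exp_pos (-t * x)
  exact ⟨by linarith, le_min (by linarith) (by linarith)⟩

lemma integrableOn_rpow_mul_one_sub_exp {x : ℝ} (hx : 0 ≤ x) :
    IntegrableOn (fun t : ℝ => t ^ (-(3 / 2) : ℝ) * (1 - Real.exp (-t * x))) (Ioi 0) := by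
  have hcont : ContinuousOn (fun t : ℝ => t ^ (-(3 / 2) : ℝ) * (1 - Real.exp (-t * x))) (Ioi 0) :=
    (continuousOn_id.rpow_const fun t ht => Or.inl (mem_Ioi.1 ht).ne').mul (by fun_prop)
  rw [← Ioc_union_Ioi_eq_Ioi zero_le_one]
  refine IntegrableOn.union ?_ ?_
  · have hi : IntegrableOn (fun t : ℝ => t ^ (-(1 / 2) : ℝ) * x) (Ioc 0 1) :=
      ((intervalIntegrable_iff_integrableOn_Ioc_of_le zero_le_one).1
        (intervalIntegral.intervalIntegrable_rpow' (by norm_num))).mul_const x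
    refine hi.mono' ((hcont.mono Ioc_subset_Ioi_self).aestronglyMeasurable measurableSet_Ioc) ?_
    filter_upwards [ae_restrict_mem measurableSet_Ioc] with t ht
    have h := one_sub_exp_neg_mul_mem_Icc ht.1.le hx
    have hp := Real.rpow_nonneg ht.1.le (-(3 / 2))
    rw [Real.norm_of_nonneg (mul_nonneg hp h.1)]
    have he : t ^ (-(1 / 2) : ℝ) = t ^ (-(3 / 2) : ℝ) * t := by
      rw [← Real.rpow_add_one ht.1.ne']; norm_num
    rw [he, mul_assoc]
    exact mul_le_mul_of_nonneg_left (h.2.trans (min_le_right _ _)) hp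
  · have hi : IntegrableOn (fun t : ℝ => t ^ (-(3 / 2) : ℝ)) (Ioi 1) :=
      integrableOn_Ioi_rpow_of_lt (by norm_num) zero_lt_one
    refine hi.mono' ((hcont.mono (Ioi_subset_Ioi zero_le_one)).aestronglyMeasurable
      measurableSet_Ioi) ?_
    filter_upwards [ae_restrict_mem measurableSet_Ioi] with t ht
    have ht0 : 0 < t := zero_lt_one.trans ht
    have h := one_sub_exp_neg_mul_mem_Icc ht0.le hx
    have hp := Real.rpow_nonneg ht0.le (-(3 / 2))
    rw [Real.norm_of_nonneg (mul_nonneg hp h.1)]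
    exact mul_le_of_le_one_right hp (h.2.trans (min_le_left _ _))

lemma integral_rpow_mul_one_sub_exp {x : ℝ} (hx : 0 < x) :
    ∫ t in Ioi (0 : ℝ), t ^ (-(3 / 2) : ℝ) * (1 - Real.exp (-t * x)) = 2 * √(π * x) := by
  have hgam : ∫ t in Ioi (0 : ℝ), t ^ (-(1 / 2) : ℝ) * Real.exp (-t * x) = √π / √x := by
    have h := Real.integral_rpow_mul_exp_neg_mul_Ioi (a := 1 / 2) (r := x) (by norm_num) hx
    rw [Real.Gamma_one_half_eq, ← Real.sqrt_eq_rpow, one_div x, Real.sqrt_inv] at h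
    rw [div_eq_inv_mul (√π), ← h]
    refine setIntegral_congr_fun measurableSet_Ioi fun t _ => ?_
    congr 2
    · norm_num
    · ring
  have hgint : IntegrableOn (fun t : ℝ => t ^ (-(1 / 2) : ℝ) * Real.exp (-t * x)) (Ioi 0) := by
    have h := integrableOn_rpow_mul_exp_neg_mul_rpow (s := -(1 / 2)) (p := 1) (b := x)
      (by norm_num) one_pos hx
    refine h.congr_fun (fun t _ => ?_) measurableSet_Ioi
    simp only [Real.rpow_one]
    congr 2
    ring
  have hqint := integrableOn_rpow_mul_one_sub_exp hx.le
  have hderiv : ∀ t ∈ Ioi (0 : ℝ), HasDerivAt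
      (fun t : ℝ => t ^ (-(1 / 2) : ℝ) * (1 - Real.exp (-t * x)))
      (-(1 / 2) * (t ^ (-(3 / 2) : ℝ) * (1 - Real.exp (-t * x))) +
        x * (t ^ (-(1 / 2) : ℝ) * Real.exp (-t * x))) t := by
    intro t ht
    have h1 := Real.hasDerivAt_rpow_const (x := t) (p := -(1 / 2)) (Or.inl (mem_Ioi.1 ht).ne')
    have h2 : HasDerivAt (fun t : ℝ => 1 - Real.exp (-t * x)) (-(Real.exp (-t * x) * (-1 * x))) t :=
      (((hasDerivAt_id t).neg.mul_const x).exp).const_sub 1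
    refine (h1.mul h2).congr_deriv ?_
    rw [show (-(1 / 2) - 1 : ℝ) = -(3 / 2) by norm_num]
    ring
  have hcont : ContinuousWithinAt (fun t : ℝ => t ^ (-(1 / 2) : ℝ) * (1 - Real.exp (-t * x)))
      (Ici 0) 0 := by
    rw [ContinuousWithinAt]
    simp only [neg_zero, zero_mul, Real.exp_zero, sub_self, mul_zero]
    have hs : Filter.Tendsto (fun t : ℝ => √t * x) (nhdsWithin 0 (Ici 0)) (nhds 0) := by
      have : Continuous fun t : ℝ => √t * x := by fun_prop
      simpa using (this.tendsto 0).mono_left nhdsWithin_le_nhds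
    refine squeeze_zero' ?_ ?_ hs
    · filter_upwards [self_mem_nhdsWithin] with t ht
      exact mul_nonneg (Real.rpow_nonneg ht _) (one_sub_exp_neg_mul_mem_Icc ht hx.le).1
    · filter_upwards [self_mem_nhdsWithin] with t ht
      rcases (mem_Ici.1 ht).eq_or_lt with rfl | ht0
      · simp
      · have h := (one_sub_exp_neg_mul_mem_Icc ht hx.le).2.trans (min_le_right _ _)
        have he : √t = t ^ (-(1 / 2) : ℝ) * t := by
          rw [← Real.rpow_add_one ht0.ne', Real.sqrt_eq_rpow]; norm_num
        rw [he, mul_assoc]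
        exact mul_le_mul_of_nonneg_left h (Real.rpow_nonneg ht _)
  have hlim : Filter.Tendsto (fun t : ℝ => t ^ (-(1 / 2) : ℝ) * (1 - Real.exp (-t * x)))
      Filter.atTop (nhds 0) := by
    refine squeeze_zero' ?_ ?_ (tendsto_rpow_neg_atTop (y := 1 / 2) (by norm_num))
    · filter_upwards [Filter.eventually_ge_atTop 0] with t ht
      exact mul_nonneg (Real.rpow_nonneg ht _) (one_sub_exp_neg_mul_mem_Icc ht hx.le).1
    · filter_upwards [Filter.eventually_ge_atTop 0] with t ht
      exact mul_le_of_le_one_right (Real.rpow_nonneg ht _)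
        ((one_sub_exp_neg_mul_mem_Icc ht hx.le).2.trans (min_le_left _ _))
  have h := integral_Ioi_of_hasDerivAt_of_tendsto hcont hderiv
    ((hqint.const_mul _).add (hgint.const_mul _)) hlim
  rw [integral_add (hqint.const_mul _) (hgint.const_mul _), integral_const_mul,
    integral_const_mul, hgam] at h
  simp only [neg_zero, zero_mul, Real.exp_zero, sub_self, mul_zero] at h
  have hxx : x * (√π / √x) = √(π * x) := by
    rw [Real.sqrt_mul Real.pi_pos.le, mul_div_assoc', div_eq_iff (Real.sqrt_pos.2 hx).ne',
      mul_assoc, Real.mul_self_sqrt hx.le, mul_comm]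
  rw [hxx] at h
  linarith

lemma rfun_eq (x : ℝ) :
    rfun x = √2 / (2 * π) * ∫ t in Ioi (0 : ℝ), rDensity t * Real.exp (-t * x) := rfl

lemma integrableOn_rDensity_mul_exp {x : ℝ} (hx : 0 ≤ x) :
    IntegrableOn (fun t => rDensity t * Real.exp (-t * x)) (Ioi 0) := by
  refine integrableOn_rDensity_and_integral.1.mono'
    (continuous_rDensity.mul (by fun_prop)).aestronglyMeasurable ?_
  filter_upwards [ae_restrict_mem measurableSet_Ioi] with t ht
  have ht : 0 < t := ht
  rw [Real.norm_of_nonneg (mul_nonneg (rDensity_nonneg ht.le) (Real.exp_pos _).le)]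
  exact mul_le_of_le_one_right (rDensity_nonneg ht.le)
    (Real.exp_le_one_iff.2 (by nlinarith [mul_nonneg ht.le hx]))

lemma rfun_nonneg (x : ℝ) : 0 ≤ rfun x := by
  rw [rfun_eq]
  exact mul_nonneg (by positivity) (setIntegral_nonneg measurableSet_Ioi fun t ht =>
    mul_nonneg (rDensity_nonneg (le_of_lt ht)) (Real.exp_pos _).le)

lemma sin_pi_div_eight_sub_rfun {x : ℝ} (hx : 0 ≤ x) :
    Real.sin (π / 8) - rfun x =
      √2 / (2 * π) * ∫ t in Ioi (0 : ℝ), rDensity t * (1 - Real.exp (-t * x)) := by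
  have h2 : √2 * √2 = 2 := Real.mul_self_sqrt zero_le_two
  have hpi := Real.pi_ne_zero
  have hsin : Real.sin (π / 8) = √2 / (2 * π) * ∫ t in Ioi (0 : ℝ), rDensity t := by
    rw [integrableOn_rDensity_and_integral.2]
    field_simp
    linear_combination (-Real.sin (π / 8)) * h2
  rw [rfun_eq, hsin, ← mul_sub, ← integral_sub integrableOn_rDensity_and_integral.1
    (integrableOn_rDensity_mul_exp hx)]
  simp only [mul_sub, mul_one]

lemma rfun_le_sin_pi_div_eight {x : ℝ} (hx : 0 ≤ x) : rfun x ≤ Real.sin (π / 8) := by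
  rw [← sub_nonneg, sin_pi_div_eight_sub_rfun hx]
  exact mul_nonneg (by positivity) (setIntegral_nonneg measurableSet_Ioi fun t ht =>
    mul_nonneg (rDensity_nonneg (le_of_lt ht))
      (one_sub_exp_neg_mul_mem_Icc (le_of_lt ht) hx).1)

lemma sin_pi_div_eight_sub_rfun_le {x : ℝ} (hx : 0 < x) :
    Real.sin (π / 8) - rfun x ≤ √(2 * x / π) := by
  have hle : ∫ t in Ioi (0 : ℝ), rDensity t * (1 - Real.exp (-t * x)) ≤ 2 * √(π * x) := by
    rw [← integral_rpow_mul_one_sub_exp hx]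
    refine integral_mono_of_nonneg ?_ (integrableOn_rpow_mul_one_sub_exp hx.le) ?_ <;>
      filter_upwards [ae_restrict_mem measurableSet_Ioi] with t ht
    · exact mul_nonneg (rDensity_nonneg (le_of_lt ht))
        (one_sub_exp_neg_mul_mem_Icc (le_of_lt ht) hx.le).1
    · exact mul_le_mul_of_nonneg_right (rDensity_le ht)
        (one_sub_exp_neg_mul_mem_Icc (le_of_lt ht) hx.le).1
  rw [sin_pi_div_eight_sub_rfun hx.le]
  refine (mul_le_mul_of_nonneg_left hle (by positivity)).trans_eq ?_
  have hp := Real.mul_self_sqrt Real.pi_pos.le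
  have hp0 := Real.sqrt_pos.2 Real.pi_pos
  rw [Real.sqrt_mul Real.pi_pos.le, Real.sqrt_div (by positivity), Real.sqrt_mul zero_le_two]
  field_simp
  rw [sq, hp]

lemma abs_psiOne_le_add {x : ℝ} (hx : 0 < x) : |psiOne x| ≤ x + √(2 * x / π) := by
  rw [psiOne, if_pos hx]
  have h1 : |Real.sin (x + π / 8) - Real.sin (π / 8)| ≤ x := by
    have := Real.abs_sin_sub_sin_le (x + π / 8) (π / 8)
    rwa [add_sub_cancel_right, abs_of_pos hx] at this
  have h2 := sin_pi_div_eight_sub_rfun_le hx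
  have h3 := rfun_le_sin_pi_div_eight hx.le
  have := abs_le.1 h1
  rw [abs_le]
  constructor <;> linarith

lemma abs_psiOne_le_two {x : ℝ} (hx : 0 < x) : |psiOne x| ≤ 2 := by
  rw [psiOne, if_pos hx]
  have h1 := rfun_nonneg x
  have h2 := (rfun_le_sin_pi_div_eight hx.le).trans (Real.sin_le_one _)
  rw [abs_le]
  constructor <;> linarith [Real.sin_le_one (x + π / 8), Real.neg_one_le_sin (x + π / 8)]

lemma add_sqrt_le_two_mul_sqrt {x : ℝ} (hx : 0 ≤ x) (hx1 : x ≤ 1) :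
    x + √(2 * x / π) ≤ 2 * √x := by
  have h1 : x ≤ √x := by
    rw [Real.le_sqrt hx hx]
    nlinarith
  have h2 : √(2 * x / π) ≤ √x := by
    refine Real.sqrt_le_sqrt ?_
    rw [div_le_iff₀ Real.pi_pos]
    nlinarith [Real.pi_gt_three]
  linarith

theorem psiOne_bound (x : ℝ) (hx : 0 < x) :
    |psiOne x| ≤ min (x + Real.sqrt (2 * x / Real.pi)) 2 ∧
    |psiOne x| ≤ min (2 * Real.sqrt x) 2 := by
  have h1 := abs_psiOne_le_add hx
  have h2 := abs_psiOne_le_two hx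
  refine ⟨le_min h1 h2, le_min ?_ h2⟩
  rcases le_total x 1 with hx1 | hx1
  · exact h1.trans (add_sqrt_le_two_mul_sqrt hx.le hx1)
  · have := Real.one_le_sqrt.2 hx1
    linarith
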